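/- arXiv:1309.6289 — 2 statements merged into one kernel-verified Lean document; each statement's English description precedes it below -/
import Mathlib

section
/- Let X be a countable subshift of finite type (SFT) over a finite alphabet A and let c ∈ X be at level 1 with a direction of periodicity v (nonzero, σ_v c = c). Let a, w ∈ ℤ×ℤ with w and v linearly independent. Then the bi-infinite sequence i ↦ c(a + i·w) (i ∈ ℤ) is eventually periodic in both directions: there exist an integer p ≥ 1 and N ∈ ℕ such that c(a + (i+p)·w) = c(a + i·w) for all i ≥ N and c(a + (i−p)·w) = c(a + i·w) for all i ≤ −N. -/
namespace CountableSubshift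

/-- A configuration over alphabet `A` on the plane `ℤ × ℤ`. -/
abbrev Config (A : Type*) := ℤ × ℤ → A

variable {A : Type*}

/-- The shift by a vector `v`. -/
def shift (v : ℤ × ℤ) (x : Config A) : Config A := fun u => x (u + v)

/-- The shift-orbit of a configuration. -/
def orbit (x : Config A) : Set (Config A) := Set.range fun v => shift v x

variable [TopologicalSpace A]

/-- `Preceq x y` iff `x` belongs to the closure of the shift-orbit of `y`. -/
def Preceq (x y : Config A) : Prop := x ∈ closure (orbit y)

/-- Strict version of `Preceq`. -/
def Prec (x y : Config A) : Prop := Preceq x y ∧ ¬ Preceq y x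

/-- `x ≈ y` : mutual `Preceq`. -/
def OrbEquiv (x y : Config A) : Prop := Preceq x y ∧ Preceq y x

/-- A subshift: nonempty, closed and shift-invariant set of configurations. -/
def IsSubshift (X : Set (Config A)) : Prop :=
  X.Nonempty ∧ IsClosed X ∧ ∀ v : ℤ × ℤ, shift v '' X = X

/-- A configuration is periodic if it has two linearly independent vectors of periodicity. -/
def Periodic (x : Config A) : Prop :=
  ∃ v w : ℤ × ℤ, shift v x = x ∧ shift w x = x ∧ LinearIndependent ℤ ![v, w]

/-- `x` is at level 0 in `X`: it is `Preceq`-minimal in `X`. -/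
def Level0 (X : Set (Config A)) (x : Config A) : Prop :=
  x ∈ X ∧ ∀ y ∈ X, Preceq y x → Preceq x y

/-- `x` is at level 1 in `X`. -/
def Level1 (X : Set (Config A)) (x : Config A) : Prop :=
  x ∈ X ∧ ¬ Level0 X x ∧ ∀ y ∈ X, Prec y x → Level0 X y

/-- `x` is at level 2 in `X`. -/
def Level2 (X : Set (Config A)) (x : Config A) : Prop :=
  x ∈ X ∧ ¬ Level0 X x ∧ ¬ Level1 X x ∧ ∀ y ∈ X, Prec y x → Level0 X y ∨ Level1 X y

/-- The pattern `p` with (finite) domain `D` appears in `x` at position `u`. -/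
def AppearsAt (D : Finset (ℤ × ℤ)) (p : ℤ × ℤ → A) (x : Config A) (u : ℤ × ℤ) : Prop :=
  ∀ d ∈ D, x (u + d) = p d

/-- A subshift of finite type: the nonempty set of configurations avoiding a
finite family of forbidden patterns. -/
def IsSFT (X : Set (Config A)) : Prop :=
  X.Nonempty ∧ ∃ (n : ℕ) (D : Fin n → Finset (ℤ × ℤ)) (p : Fin n → ℤ × ℤ → A),
    X = {x : Config A | ∀ (i : Fin n) (u : ℤ × ℤ), ¬ AppearsAt (D i) (p i) x u}

/-- Every pattern appearing in `c` appears at infinitely many positions. -/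
def AllPatternsInfinite (c : Config A) : Prop :=
  ∀ (D : Finset (ℤ × ℤ)) (u : ℤ × ℤ),
    {u' : ℤ × ℤ | ∀ d ∈ D, c (u' + d) = c (u + d)}.Infinite

/-- The standard dot product on `ℤ × ℤ`. -/
def dot (u w : ℤ × ℤ) : ℤ := u.1 * w.1 + u.2 * w.2

/-- A sequence `f` over a finite alphabet is eventually periodic to the right as soon as there are
only countably many bi-infinite walks using the transitions `f e → f (e + 1)`. -/
theorem eventually_periodic_of_countable_walks {S : Type*} [Finite S] (f : ℤ → S)
    (hf : {h : ℤ → S | ∀ m, ∃ e, h m = f e ∧ h (m + 1) = f (e + 1)}.Countable) :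
    ∃ p : ℤ, 1 ≤ p ∧ ∃ N : ℤ, ∀ m, N ≤ m → f (m + p) = f m := by
  classical
  obtain ⟨s, hs⟩ := Finite.exists_infinite_fiber (fun n : ℕ => f n)
  have hinf : ((fun n : ℕ => f n) ⁻¹' {s}).Infinite := Set.infinite_coe_iff.mp hs
  have visit : ∀ b : ℤ, ∃ k : ℤ, b < k ∧ f k = s := by
    intro b
    obtain ⟨k, hk, hbk⟩ := hinf.exists_gt b.toNat
    exact ⟨k, by omega, hk⟩
  obtain ⟨i, -, hi⟩ := visit 0
  obtain ⟨j, hij, hj⟩ := visit i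
  refine ⟨j - i, by omega, i, fun m hm => ?_⟩
  obtain ⟨k, hmk, hk⟩ := visit (m + (j - i))
  by_contra hne
  have hn : 0 < k - i := by omega
  -- Read the loops `[i, j)` and `[j, k)` in the original or in the swapped order.
  let src : Prop → ℤ → ℤ := fun b r =>
    if b then i + r else if r < k - j then j + r else i + r - (k - j)
  let walk : Set ℤ → ℤ → S := fun b x => f (src (x / (k - i) ∈ b) (x % (k - i)))
  have step : ∀ (b : Prop) (r : ℤ), 0 ≤ r → r + 1 < k - i →
      f (src b (r + 1)) = f (src b r + 1) := by
    intro b r h0 h1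
    by_cases hb : b
    · simp only [src, hb, if_true]
      congr 1
      ring
    · simp only [src, hb, if_false]
      rcases lt_trichotomy (r + 1) (k - j) with h | h | h
      · rw [if_pos h, if_pos (by omega)]
        congr 1
        ring
      · rw [if_neg (by omega), if_pos (by omega), show i + (r + 1) - (k - j) = i by omega,
          show j + r + 1 = k by omega, hi, hk]
      · rw [if_neg (by omega), if_neg (by omega)]
        congr 1
        ring
  have start : ∀ b : Prop, f (src b 0) = s := by
    intro b
    by_cases hb : b
    · simpa [src, hb] using hi
    · simp only [src, hb, if_false]
      rw [if_pos (by omega), add_zero, hj]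
  have finish : ∀ b : Prop, f (src b (k - i - 1) + 1) = s := by
    intro b
    by_cases hb : b
    · simp only [src, hb, if_true]
      rw [show i + (k - i - 1) + 1 = k by ring, hk]
    · simp only [src, hb, if_false]
      rw [if_neg (by omega), show i + (k - i - 1) - (k - j) + 1 = j by ring, hj]
  have walk_mem : ∀ b, walk b ∈ {h : ℤ → S | ∀ m, ∃ e, h m = f e ∧ h (m + 1) = f (e + 1)} := by
    intro b x
    refine ⟨src (x / (k - i) ∈ b) (x % (k - i)), rfl, ?_⟩
    have h0 := Int.emod_nonneg x hn.ne'
    have h1 := Int.emod_lt_of_pos x hn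
    have hx := Int.emod_add_mul_ediv x (k - i)
    simp only [walk]
    rcases (show x % (k - i) + 1 < k - i ∨ x % (k - i) = k - i - 1 by omega) with h | h
    · have hqr := (Int.ediv_emod_unique (a := x + 1) (q := x / (k - i))
        (r := x % (k - i) + 1) hn).2 ⟨by linarith, by omega, h⟩
      rw [hqr.1, hqr.2, step _ _ h0 h]
    · have hqr := (Int.ediv_emod_unique (a := x + 1) (q := x / (k - i) + 1)
        (r := 0) hn).2 ⟨by linear_combination hx - h, le_rfl, hn⟩
      rw [hqr.1, hqr.2, h, start, finish]
  have walk_inj : Function.Injective walk := by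
    intro b b' hbb
    ext z
    have hqr := (Int.ediv_emod_unique (a := m - i + (k - i) * z) (q := z) (r := m - i) hn).2
      ⟨rfl, by omega, by omega⟩
    have hz := congrFun hbb (m - i + (k - i) * z)
    simp only [walk, hqr.1, hqr.2, src] at hz
    rw [if_pos (show m - i < k - j by omega), show i + (m - i) = m by ring,
      show j + (m - i) = m + (j - i) by ring] at hz
    by_cases h : z ∈ b <;> by_cases h' : z ∈ b' <;> simp only [h, h', if_true, if_false] at hz ⊢
    · exact absurd hz.symm hne
    · exact absurd hz hne
  obtain ⟨code, hcode⟩ := hf.to_subtype.exists_injective_nat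
  exact Function.cantor_injective
    (fun b : Set ℤ => ((code ⟨walk b, walk_mem b⟩ : ℕ) : ℤ)) fun b b' h =>
      walk_inj (congrArg Subtype.val (hcode (Int.ofNat_injective h)))

/-- A configuration fixed by `shift v` is invariant under all integer multiples of `v`. -/
theorem apply_add_zsmul_of_shift_eq {α : Type*} {v : ℤ × ℤ} {c : Config α} (h : shift v c = c) (k : ℤ)
    (u : ℤ × ℤ) : c (u + k • v) = c u := by
  have hp : Function.Periodic c v := fun u => congrFun h u
  exact hp.zsmul k u

/-- The cross product of two vectors of the lattice. -/
def cross (u w : ℤ × ℤ) : ℤ := u.1 * w.2 - u.2 * w.1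

theorem cross_add (u u' w : ℤ × ℤ) : cross (u + u') w = cross u w + cross u' w := by
  simp only [cross, Prod.fst_add, Prod.snd_add]; ring

theorem cross_zsmul (k : ℤ) (u w : ℤ × ℤ) : cross (k • u) w = k * cross u w := by
  simp only [cross, Prod.smul_fst, Prod.smul_snd, smul_eq_mul]; ring

theorem cross_swap (u w : ℤ × ℤ) : cross u w = -cross w u := by
  simp only [cross]; ring

theorem cross_self (u : ℤ × ℤ) : cross u u = 0 := by
  simp only [cross]; ring

theorem cross_ne_zero_of_linearIndependent {w v : ℤ × ℤ} (h : LinearIndependent ℤ ![w, v]) :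
    cross w v ≠ 0 := by
  intro h0
  rw [LinearIndependent.pair_iff] at h
  simp only [cross] at h0
  have h1 := h v.1 (-w.1) (by ext <;> simp <;> linarith)
  have h2 := h v.2 (-w.2) (by ext <;> simp <;> linarith)
  have := h 1 0 (by ext <;> simp <;> omega)
  omega

/-- If the strips of a `v`-periodic configuration `c` between consecutive translates by `W` are
wide enough, then any walk on strips using the transitions of `c` gives a configuration of the
subshift; hence `c` is eventually periodic along `W` when the subshift is countable. -/
theorem strips_eventually_periodic {α : Type*} [Finite α] {n : ℕ} (D : Fin n → Finset (ℤ × ℤ))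
    (P : Fin n → ℤ × ℤ → α)
    (hcount : {x : Config α | ∀ i u, ¬ AppearsAt (D i) (P i) x u}.Countable)
    {c : Config α} (hc : ∀ i u, ¬ AppearsAt (D i) (P i) c u)
    {v W : ℤ × ℤ} (hvc : shift v c = c) {B : ℤ}
    (hB : ∀ i, ∀ δ ∈ D i, |cross δ v| ≤ B) (hW : 2 * B < cross W v) (hpos : 0 < cross W v) :
    ∃ p : ℤ, 1 ≤ p ∧ ∃ N : ℤ, ∀ u, N * cross W v ≤ cross u v → c (u + p • W) = c u := by
  set d := cross W v with hd
  have hvW : cross v W = -d := cross_swap v W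
  let q : ℤ × ℤ → ℤ := fun u => cross u v / d
  let t : ℤ × ℤ → ℤ := fun u => -cross u W / d
  have q_add : ∀ (u : ℤ × ℤ) (k : ℤ), q (u + k • W) = q u + k := by
    intro u k
    simp only [q, cross_add, cross_zsmul, ← hd]
    exact Int.add_mul_ediv_right _ _ hpos.ne'
  have t_add : ∀ (u : ℤ × ℤ) (k : ℤ), t (u + k • W) = t u := by
    intro u k
    simp only [t, cross_add, cross_zsmul, cross_self, mul_zero, add_zero]
  have q_add' : ∀ (u : ℤ × ℤ) (k : ℤ), q (u + k • v) = q u := by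
    intro u k
    simp only [q, cross_add, cross_zsmul, cross_self, mul_zero, add_zero]
  have t_add' : ∀ (u : ℤ × ℤ) (k : ℤ), t (u + k • v) = t u + k := by
    intro u k
    simp only [t, cross_add, cross_zsmul, hvW]
    rw [show -(cross u W + k * -d) = -cross u W + k * d by ring]
    exact Int.add_mul_ediv_right _ _ hpos.ne'
  -- The fundamental domain of the lattice spanned by `v` and `W`.
  let R := {r : ℤ × ℤ | q r = 0 ∧ t r = 0}
  have hR : Finite R := by
    refine Set.Finite.of_finite_image (f := fun r => (cross r v, -cross r W))
      (((Set.finite_Ico 0 d).prod (Set.finite_Ico 0 d)).subset ?_) ?_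
    · rintro _ ⟨r, ⟨h1, h2⟩, rfl⟩
      have key : ∀ z : ℤ, z / d = 0 → z ∈ Set.Ico 0 d := by
        intro z hz
        have h := Int.emod_add_mul_ediv z d
        rw [hz, mul_zero, add_zero] at h
        rw [← h]
        exact ⟨Int.emod_nonneg z hpos.ne', Int.emod_lt_of_pos z hpos⟩
      exact ⟨key _ h1, key _ h2⟩
    · intro r _ r' _ h
      simp only [Prod.mk.injEq, neg_inj] at h
      obtain ⟨h1, h2⟩ := h
      simp only [cross] at h1 h2 hd
      ext
      · refine mul_left_cancel₀ hpos.ne' ?_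
        rw [hd]
        linear_combination W.1 * h1 - v.1 * h2
      · refine mul_left_cancel₀ hpos.ne' ?_
        rw [hd]
        linear_combination W.2 * h1 - v.2 * h2
  have decomp : ∀ u, ∃ r : R, ∃ k : ℤ, u = (r : ℤ × ℤ) + k • v + q u • W := by
    intro u
    refine ⟨⟨u + (-q u) • W + (-t u) • v, ?_, ?_⟩, t u, ?_⟩
    · rw [q_add', q_add]; ring
    · rw [t_add', t_add]; ring
    · simp only [neg_smul]; abel
  choose rep coeff hrep using decomp
  have rep_eq : ∀ (r : R) (k m : ℤ), rep ((r : ℤ × ℤ) + k • v + m • W) = r := by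
    intro r k m
    set u := (r : ℤ × ℤ) + k • v + m • W with hu
    have h := hrep u
    have hq : q u = m := by rw [hu, q_add, q_add', r.2.1, zero_add]
    have ht : t u = k := by rw [hu, t_add, t_add', r.2.2, zero_add]
    have ht' : t u = coeff u := by
      conv_lhs => rw [h]
      rw [t_add, t_add', (rep u).2.2, zero_add]
    rw [← ht', ht, hq, hu] at h
    exact Subtype.ext (add_right_cancel (add_right_cancel h)).symm
  have rep_add : ∀ (u : ℤ × ℤ) (k : ℤ), rep (u + k • W) = rep u := by
    intro u k
    conv_lhs => rw [hrep u, add_assoc, ← add_smul]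
    exact rep_eq _ _ _
  let g : ℤ → R → α := fun m r => c (r + m • W)
  let glue : (ℤ → R → α) → Config α := fun h u => h (q u) (rep u)
  have glue_g : ∀ u, c u = g (q u) (rep u) := by
    intro u
    conv_lhs => rw [hrep u, add_right_comm]
    exact apply_add_zsmul_of_shift_eq hvc _ _
  have glue_inj : Function.Injective glue := by
    intro h h' hh
    funext m r
    have hx := congrFun hh ((r : ℤ × ℤ) + (0 : ℤ) • v + m • W)
    simpa only [glue, rep_eq, q_add, q_add', r.2.1, zero_add] using hx
  have glue_mem : ∀ h ∈ {h : ℤ → R → α | ∀ m, ∃ e, h m = g e ∧ h (m + 1) = g (e + 1)},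
      glue h ∈ {x : Config α | ∀ i u, ¬ AppearsAt (D i) (P i) x u} := by
    intro h hh i u happ
    obtain ⟨e, he, he'⟩ := hh ((cross u v - B) / d)
    set m := (cross u v - B) / d with hm
    refine hc i (u + (e - m) • W) fun δ hδ => ?_
    rw [← happ δ hδ, add_right_comm, glue_g, q_add, rep_add]
    have hδ := abs_le.mp (hB i δ hδ)
    have h0 := Int.emod_nonneg (cross u v - B) hpos.ne'
    have h1 := Int.emod_lt_of_pos (cross u v - B) hpos
    have hx := Int.emod_add_mul_ediv (cross u v - B) d
    rw [← hm] at hx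
    have hcase : q (u + δ) = m ∨ q (u + δ) = m + 1 := by
      have hl : m ≤ q (u + δ) := by
        refine (Int.le_ediv_iff_mul_le hpos).2 ?_
        rw [cross_add]
        linarith [mul_comm m d]
      have hr : q (u + δ) < m + 2 := by
        refine (Int.ediv_lt_iff_lt_mul hpos).2 ?_
        rw [cross_add]
        linarith [mul_comm m d]
      omega
    simp only [glue]
    rcases hcase with hq | hq
    · rw [hq, he, add_sub_cancel]
    · rw [hq, he', show m + 1 + (e - m) = e + 1 by ring]
  have hwalks : {h : ℤ → R → α | ∀ m, ∃ e, h m = g e ∧ h (m + 1) = g (e + 1)}.Countable :=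
    (hcount.preimage_of_injOn glue_inj.injOn).mono glue_mem
  obtain ⟨p, hp, N, hN⟩ := eventually_periodic_of_countable_walks g hwalks
  refine ⟨p, hp, N, fun u hu => ?_⟩
  rw [glue_g (u + p • W), glue_g u, q_add, rep_add, hN _ ((Int.le_ediv_iff_mul_le hpos).2 hu)]

/-- Eventual periodicity to the right of a `v`-periodic configuration of a countable SFT. -/
theorem eventually_periodic_right {α : Type*} [Finite α] {X : Set (Config α)} (hX : IsSFT X)
    (hcount : X.Countable) {c : Config α} (hc : c ∈ X) {v w : ℤ × ℤ} (hvc : shift v c = c)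
    (hw : cross w v ≠ 0) (a : ℤ × ℤ) :
    ∃ p : ℤ, 1 ≤ p ∧ ∃ N : ℕ, ∀ i : ℤ, (N : ℤ) ≤ i → c (a + (i + p) • w) = c (a + i • w) := by
  wlog hpos : 0 < cross w v generalizing v
  · have hneg : cross w (-v) = -cross w v := by
      simp only [cross, Prod.fst_neg, Prod.snd_neg]; ring
    refine this (v := -v) ?_ (by omega) (by omega)
    funext u
    simpa [shift] using apply_add_zsmul_of_shift_eq hvc (-1) u
  obtain ⟨-, n, D, P, rfl⟩ := hX
  obtain ⟨B, hB⟩ := ((Finset.univ.biUnion D).image fun δ => |cross δ v|).bddAbove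
  have hB' : ∀ i, ∀ δ ∈ D i, |cross δ v| ≤ |B| := fun i δ hδ =>
    (hB (Finset.mem_coe.2 (Finset.mem_image_of_mem _
      (Finset.mem_biUnion.2 ⟨i, Finset.mem_univ i, hδ⟩)))).trans (le_abs_self B)
  have hB0 := abs_nonneg B
  set K := 2 * |B| + 1 with hK
  have hKw : K ≤ cross (K • w) v := by
    rw [cross_zsmul]
    nlinarith
  obtain ⟨p, hp, N, hN⟩ := strips_eventually_periodic D P hcount hc (W := K • w) hvc hB'
    (by omega) (by omega)
  refine ⟨p * K, by nlinarith, (|cross a v| + |N * cross (K • w) v|).toNat, fun i hi => ?_⟩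
  rw [add_smul, ← add_assoc, mul_smul]
  apply hN
  rw [cross_add, cross_zsmul i]
  have h1 := neg_abs_le (cross a v)
  have h2 := le_abs_self (N * cross (K • w) v)
  have h3 := abs_nonneg (cross a v)
  have h4 := abs_nonneg (N * cross (K • w) v)
  have hi' : |cross a v| + |N * cross (K • w) v| ≤ i := by omega
  nlinarith

theorem stmt12 {A : Type*} [Fintype A] [Nonempty A] [TopologicalSpace A] [DiscreteTopology A]
    (X : Set (Config A)) (hX : IsSFT X) (hcount : X.Countable)
    (c : Config A) (hc : Level1 X c)
    (v : ℤ × ℤ) (hv : v ≠ 0) (hvc : shift v c = c)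
    (a w : ℤ × ℤ) (hw : LinearIndependent ℤ ![w, v]) :
    ∃ p : ℤ, 1 ≤ p ∧ ∃ N : ℕ,
      (∀ i : ℤ, (N : ℤ) ≤ i → c (a + (i + p) • w) = c (a + i • w)) ∧
      (∀ i : ℤ, i ≤ -(N : ℤ) → c (a + (i - p) • w) = c (a + i • w)) := by
  have hdet := cross_ne_zero_of_linearIndependent hw
  have hdet' : cross (-w) v ≠ 0 := by
    rw [← neg_one_zsmul, cross_zsmul]
    omega
  obtain ⟨p, hp, N, hN⟩ := eventually_periodic_right hX hcount hc.1 hvc hdet a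
  obtain ⟨p', hp', N', hN'⟩ := eventually_periodic_right hX hcount hc.1 hvc hdet' a
  have iter : ∀ k : ℕ, ∀ i : ℤ, (N : ℤ) ≤ i → c (a + (i + k * p) • w) = c (a + i • w) := by
    intro k
    induction k with
    | zero => intro i _; simp
    | succ k ih =>
      intro i hi
      rw [← ih i hi, ← hN (i + k * p) (by nlinarith)]
      push_cast
      ring_nf
  have iter' : ∀ k : ℕ, ∀ i : ℤ, i ≤ -(N' : ℤ) →
      c (a + (i - k * p') • w) = c (a + i • w) := by
    intro k
    induction k with
    | zero => intro i _; simp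
    | succ k ih =>
      intro i hi
      have h := hN' (-(i - k * p')) (by nlinarith)
      simp only [smul_neg, neg_smul, neg_neg] at h
      rw [← ih i hi, ← h, ← neg_smul]
      push_cast
      ring_nf
  lift p to ℕ using by omega
  lift p' to ℕ using by omega
  refine ⟨p * p', by nlinarith, max N N', fun i hi => ?_, fun i hi => ?_⟩
  · rw [mul_comm]
    exact iter p' i (by push_cast at hi; omega)
  · exact iter' p i (by push_cast at hi; omega)

end CountableSubshift
end

section
/- Let X be a countable subshift of finite type (SFT) over a finite alphabet A and let c ∈ X be at level 1. Then c has exactly two configurations modulo shift strictly below it: there exist y₁, y₂ ∈ X with y₁ ≺ c, y₂ ≺ c, ¬(y₁ ≈ y₂), and every y ∈ X with y ≺ c satisfies y ≈ y₁ or y ≈ y₂. -/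
namespace CountableSubshift

variable {A : Type*}

variable [TopologicalSpace A]

/-! ### Shifts, orbits and isolated points -/

section Shift

variable {A : Type*}

lemma shift_apply (v u : ℤ × ℤ) (x : Config A) : shift v x u = x (u + v) := rfl

lemma shift_shift (v w : ℤ × ℤ) (x : Config A) : shift v (shift w x) = shift (v + w) x := by
  funext u
  simp only [shift_apply, add_assoc]

lemma shift_zero (x : Config A) : shift 0 x = x := by
  funext u
  simp [shift_apply]

lemma shift_neg_shift (v : ℤ × ℤ) (x : Config A) : shift (-v) (shift v x) = x := by
  rw [shift_shift, neg_add_cancel, shift_zero]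

lemma shift_shift_neg (v : ℤ × ℤ) (x : Config A) : shift v (shift (-v) x) = x := by
  rw [shift_shift, add_neg_cancel, shift_zero]

lemma shift_injective (v : ℤ × ℤ) : Function.Injective (shift v : Config A → Config A) :=
  Function.LeftInverse.injective (g := shift (-v)) (shift_neg_shift v)

lemma shift_sub_eq_self {v w : ℤ × ℤ} {x : Config A} (h : shift v x = shift w x) :
    shift (v - w) x = x := by
  rw [sub_eq_add_neg, add_comm, ← shift_shift, h, shift_neg_shift]

lemma shift_mem_orbit (v : ℤ × ℤ) (x : Config A) : shift v x ∈ orbit x := ⟨v, rfl⟩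

lemma mem_orbit_self (x : Config A) : x ∈ orbit x := ⟨0, shift_zero x⟩

lemma shift_mem_orbit_of_mem {x y : Config A} (v : ℤ × ℤ) (h : x ∈ orbit y) :
    shift v x ∈ orbit y := by
  obtain ⟨w, rfl⟩ := h
  exact ⟨v + w, (shift_shift v w y).symm⟩

lemma mem_orbit_symm {x y : Config A} (h : x ∈ orbit y) : y ∈ orbit x := by
  obtain ⟨w, rfl⟩ := h
  exact ⟨-w, shift_neg_shift w y⟩

lemma nsmul_period {x : Config A} {v : ℤ × ℤ} (h : shift v x = x) (n : ℕ) :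
    shift (n • v) x = x := by
  induction n with
  | zero => rw [zero_smul, shift_zero]
  | succ n ih => rw [succ_nsmul, ← shift_shift, h, ih]

lemma zsmul_period {x : Config A} {v : ℤ × ℤ} (h : shift v x = x) (n : ℤ) :
    shift (n • v) x = x := by
  obtain ⟨k, rfl | rfl⟩ := n.eq_nat_or_neg
  · rw [natCast_zsmul, nsmul_period h]
  · rw [neg_smul, natCast_zsmul]
    nth_rewrite 1 [← nsmul_period h k]
    rw [shift_neg_shift]

lemma exists_nsmul_period {x : Config A} (hx : (orbit x).Finite) (v : ℤ × ℤ) :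
    ∃ n : ℕ, 0 < n ∧ shift (n • v) x = x := by
  obtain ⟨i, -, j, -, hij, h⟩ := Set.infinite_univ.exists_lt_map_eq_of_mapsTo
    (f := fun n : ℕ => shift (n • v) x) (fun n _ => shift_mem_orbit _ _) hx
  refine ⟨j - i, by omega, ?_⟩
  rw [sub_nsmul _ hij.le, ← sub_eq_add_neg]
  exact shift_sub_eq_self h.symm

/-- A set of positions stable under unit steps and containing the origin is everything. -/
lemma forall_of_unit_steps {G : ℤ × ℤ → Prop} (h0 : G 0)
    (h : ∀ v, G v → G (v + (1, 0)) ∧ G (v + (-1, 0)) ∧ G (v + (0, 1)) ∧ G (v + (0, -1)))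
    (v : ℤ × ℤ) : G v := by
  have h1 : ∀ i : ℤ, G (i, 0) := by
    intro i
    induction i using Int.induction_on with
    | zero => exact h0
    | succ i ih => simpa using (h _ ih).1
    | pred i ih => simpa [sub_eq_add_neg] using (h _ ih).2.1
  have h2 : ∀ i j : ℤ, G (i, j) := by
    intro i j
    induction j using Int.induction_on with
    | zero => exact h1 i
    | succ j ih => simpa using (h _ ih).2.2.1
    | pred j ih => simpa [sub_eq_add_neg] using (h _ ih).2.2.2
  exact h2 v.1 v.2

lemma IsSFT.shift_mem {X : Set (Config A)} (hX : IsSFT X) (v : ℤ × ℤ) {x : Config A}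
    (hx : x ∈ X) : shift v x ∈ X := by
  obtain ⟨-, n, D, p, rfl⟩ := hX
  intro i u h
  refine hx i (u + v) fun d hd => ?_
  rw [← h d hd, shift_apply, add_right_comm]

end Shift

lemma finite_image_of_factor {α β γ : Type*} {T : Set α} {f : α → β} {g : α → γ}
    (hf : (f '' T).Finite) (h : ∀ a b, f a = f b → g a = g b) : (g '' T).Finite := by
  rcases isEmpty_or_nonempty α with hα | hα
  · exact Set.toFinite _
  have : ∀ b ∈ f '' T, ∃ a, f a = b := fun b ⟨a, _, ha⟩ => ⟨a, ha⟩
  choose! r hr using this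
  refine (hf.image (g ∘ r)).subset ?_
  rintro _ ⟨a, ha, rfl⟩
  exact ⟨f a, ⟨a, ha, rfl⟩, h _ _ (hr _ ⟨a, ha, rfl⟩)⟩

section Isolated

/-- `x` is an isolated point of `S`. -/
def IsolatedIn {E : Type*} [TopologicalSpace E] (S : Set E) (x : E) : Prop :=
  x ∈ S ∧ ∃ V, IsOpen V ∧ x ∈ V ∧ (V ∩ S).Subsingleton

variable {E : Type*} [TopologicalSpace E] {S T : Set E}

lemma IsolatedIn.mono {x : E} (h : IsolatedIn S x) (hTS : T ⊆ S) (hx : x ∈ T) :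
    IsolatedIn T x := by
  obtain ⟨-, V, hV, hxV, hs⟩ := h
  exact ⟨hx, V, hV, hxV, hs.anti (Set.inter_subset_inter_right _ hTS)⟩

lemma isClosed_nonIsolated (hS : IsClosed S) : IsClosed {x ∈ S | ¬ IsolatedIn S x} := by
  have : {x ∈ S | ¬ IsolatedIn S x} =
      S ∩ (⋃₀ {V : Set E | IsOpen V ∧ (V ∩ S).Subsingleton})ᶜ := by
    ext x
    simp only [IsolatedIn, Set.mem_ofPred_eq, Set.mem_inter_iff, Set.mem_compl_iff,
      Set.mem_sUnion]
    constructor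
    · rintro ⟨hx, h⟩
      exact ⟨hx, fun ⟨V, ⟨h1, h2⟩, h3⟩ => h ⟨hx, V, h1, h3, h2⟩⟩
    · rintro ⟨hx, h⟩
      exact ⟨hx, fun ⟨_, V, h1, h3, h2⟩ => h ⟨V, ⟨h1, h2⟩, h3⟩⟩
  rw [this]
  exact hS.inter (isOpen_sUnion fun V hV => hV.1).isClosed_compl

lemma isolatedIn_of_finite_inter [T1Space E] {U : Set E} {x : E} (hx : x ∈ S) (hU : IsOpen U)
    (hxU : x ∈ U) (hfin : (U ∩ S).Finite) : IsolatedIn S x := by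
  refine ⟨hx, U \ ((U ∩ S) \ {x}), hU.sdiff (hfin.subset Set.sdiff_subset).isClosed,
    ⟨hxU, fun h => h.2 rfl⟩, ?_⟩
  have key : ∀ a ∈ (U \ ((U ∩ S) \ {x})) ∩ S, a = x := by
    rintro a ⟨⟨haU, ha⟩, haS⟩
    by_contra hne
    exact ha ⟨⟨haU, haS⟩, hne⟩
  intro a ha b hb
  rw [key a ha, key b hb]

lemma finite_of_forall_isolatedIn (hS : IsCompact S) (h : ∀ x ∈ S, IsolatedIn S x) :
    S.Finite := by
  by_contra hinf
  obtain ⟨x, hx, hacc⟩ := Set.Infinite.exists_accPt_of_subset_isCompact hinf hS subset_rfl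
  obtain ⟨-, V, hV, hxV, hs⟩ := h x hx
  rw [accPt_iff_nhds] at hacc
  obtain ⟨y, hy, hne⟩ := hacc V (hV.mem_nhds hxV)
  exact hne (hs hy ⟨hxV, hx⟩)

lemma exists_isolatedIn [CompactSpace E] [T2Space E] (hS : IsClosed S) (hne : S.Nonempty)
    (hc : S.Countable) : ∃ x, IsolatedIn S x := by
  have : CompactSpace S := isCompact_iff_compactSpace.mp hS.isCompact
  have : Nonempty S := hne.to_subtype
  have : Countable S := hc.to_subtype
  obtain ⟨x, z, hz⟩ := nonempty_interior_of_iUnion_of_closed (f := fun x : S => ({x} : Set S))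
    (fun x => isClosed_singleton) (by ext; simp)
  obtain ⟨W, hW, hWo, hzW⟩ := mem_interior.mp hz
  obtain ⟨V, hV, rfl⟩ := isOpen_induced_iff.mp hWo
  refine ⟨z, z.2, V, hV, hzW, ?_⟩
  intro a ha b hb
  have h1 := hW (show (⟨a, ha.2⟩ : S) ∈ _ from ha.1)
  have h2 := hW (show (⟨b, hb.2⟩ : S) ∈ _ from hb.1)
  exact congrArg Subtype.val
    ((Set.mem_singleton_iff.mp h1).trans (Set.mem_singleton_iff.mp h2).symm)

end Isolated

section Topology

variable {A : Type*} [TopologicalSpace A]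

lemma continuous_shift (v : ℤ × ℤ) : Continuous (shift v : Config A → Config A) :=
  continuous_pi fun u => continuous_apply (u + v)

lemma shift_mem_closure_orbit {x y : Config A} (v : ℤ × ℤ) (h : x ∈ closure (orbit y)) :
    shift v x ∈ closure (orbit y) :=
  map_mem_closure (continuous_shift v) h fun _ hz => shift_mem_orbit_of_mem v hz

lemma preceq_of_mem_orbit {x y : Config A} (h : x ∈ orbit y) : Preceq x y := subset_closure h

lemma orbEquiv_of_mem_orbit {x y : Config A} (h : x ∈ orbit y) : OrbEquiv x y :=
  ⟨preceq_of_mem_orbit h, preceq_of_mem_orbit (mem_orbit_symm h)⟩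

lemma isolatedIn_shift_iff {S : Set (Config A)} (hS : ∀ v, ∀ x ∈ S, shift v x ∈ S)
    (v : ℤ × ℤ) (x : Config A) : IsolatedIn S (shift v x) ↔ IsolatedIn S x := by
  have key : ∀ v x, IsolatedIn S (shift v x) → IsolatedIn S x := by
    rintro v x ⟨hx, V, hV, hxV, hs⟩
    refine ⟨by simpa only [shift_neg_shift] using hS (-v) _ hx, shift v ⁻¹' V,
      hV.preimage (continuous_shift v), hxV, ?_⟩
    intro a ha b hb
    exact shift_injective v (hs ⟨ha.1, hS v a ha.2⟩ ⟨hb.1, hS v b hb.2⟩)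
  exact ⟨key v x, fun h => key (-v) _ (by rwa [shift_neg_shift])⟩

/-- If `c` is isolated in its orbit closure, then every point of that closure above `c` is a
shift of `c`. -/
lemma mem_orbit_of_preceq {c x : Config A} (hc : IsolatedIn (closure (orbit c)) c)
    (hx : Preceq x c) (hcx : Preceq c x) : x ∈ orbit c := by
  obtain ⟨hcc, V, hV, hcV, hs⟩ := hc
  obtain ⟨_, hzV, v, rfl⟩ := mem_closure_iff.mp hcx V hV hcV
  have : shift v x = c := hs ⟨hzV, shift_mem_closure_orbit v hx⟩ ⟨hcV, hcc⟩
  exact mem_orbit_symm ⟨v, this⟩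

variable [DiscreteTopology A]

lemma IsSFT.isClosed {X : Set (Config A)} (hX : IsSFT X) : IsClosed X := by
  obtain ⟨-, n, D, p, rfl⟩ := hX
  have hopen : ∀ i u, IsOpen {x : Config A | AppearsAt (D i) (p i) x u} := by
    intro i u
    simp only [AppearsAt, Set.ofPred_forall]
    exact isOpen_biInter_finset fun d _ => (isOpen_discrete {p i d}).preimage
      (f := fun x : Config A => x (u + d)) (continuous_apply (u + d))
  simp only [Set.ofPred_forall]
  exact isClosed_iInter fun i => isClosed_iInter fun u => (hopen i u).isClosed_compl

lemma IsSFT.closure_orbit_subset {X : Set (Config A)} (hX : IsSFT X) {x : Config A}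
    (hx : x ∈ X) : closure (orbit x) ⊆ X :=
  closure_minimal (by rintro _ ⟨v, rfl⟩; exact hX.shift_mem v hx) hX.isClosed

variable [Fintype A]

lemma isolatedIn_closure_orbit {c : Config A} (h : (closure (orbit c)).Countable) :
    IsolatedIn (closure (orbit c)) c := by
  obtain ⟨x, hx⟩ := exists_isolatedIn isClosed_closure ⟨c, subset_closure (mem_orbit_self c)⟩ h
  obtain ⟨hxK, V, hV, hxV, hs⟩ := id hx
  obtain ⟨_, hzV, v, rfl⟩ := mem_closure_iff.mp hxK V hV hxV
  have : shift v c = x := hs ⟨hzV, subset_closure (shift_mem_orbit v c)⟩ ⟨hxV, hxK⟩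
  rw [← this, isolatedIn_shift_iff fun v x hx => shift_mem_closure_orbit v hx] at hx
  exact hx

/-- Minimal configurations of a countable SFT have finite orbits. -/
lemma Level0.finite_orbit {X : Set (Config A)} (hX : IsSFT X) (hcount : X.Countable)
    {x : Config A} (hx : Level0 X x) : (orbit x).Finite := by
  have hsub := hX.closure_orbit_subset hx.1
  have hiso := isolatedIn_closure_orbit (hcount.mono hsub)
  have heq : ∀ z ∈ closure (orbit x), z ∈ orbit x := fun z hz =>
    mem_orbit_of_preceq hiso hz (hx.2 z (hsub hz) hz)
  refine (finite_of_forall_isolatedIn isClosed_closure.isCompact fun z hz => ?_).subset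
    subset_closure
  obtain ⟨v, rfl⟩ := heq z hz
  exact (isolatedIn_shift_iff (fun v x hx => shift_mem_closure_orbit v hx) v x).mpr hiso

end Topology

/-! ### Coherent windows -/

section Window

variable {A : Type*}

/-- `x` and `y` coincide on the window `D`. -/
def Agree (D : Finset (ℤ × ℤ)) (x y : Config A) : Prop := ∀ d ∈ D, x d = y d

/-- The configurations whose restriction to the window `D` is that of some element of `O`. -/
def Seen (O : Set (Config A)) (D : Finset (ℤ × ℤ)) : Set (Config A) :=
  {x | ∃ o ∈ O, Agree D x o}

/-- The four unit vectors. -/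
def unitSteps : Finset (ℤ × ℤ) := {(1, 0), (-1, 0), (0, 1), (0, -1)}

/-- The window `D` is large enough to separate the elements of the shift-invariant set `O` and to
propagate agreement with elements of `O` from a position to its neighbours. -/
structure Coherent (O : Set (Config A)) (D : Finset (ℤ × ℤ)) : Prop where
  shift_mem : ∀ v, ∀ o ∈ O, shift v o ∈ O
  zero_mem : (0 : ℤ × ℤ) ∈ D
  sep : ∀ o ∈ O, ∀ o' ∈ O, Agree D o o' → o = o'
  step : ∀ e ∈ unitSteps, ∀ x, ∀ o ∈ O, ∀ o' ∈ O,
    Agree D x o → Agree D (shift e x) o' → o' = shift e o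

lemma Agree.symm {D : Finset (ℤ × ℤ)} {x y : Config A} (h : Agree D x y) : Agree D y x :=
  fun d hd => (h d hd).symm

lemma Agree.trans {D : Finset (ℤ × ℤ)} {x y z : Config A} (h : Agree D x y)
    (h' : Agree D y z) : Agree D x z :=
  fun d hd => (h d hd).trans (h' d hd)

lemma subset_seen {O : Set (Config A)} {D : Finset (ℤ × ℤ)} : O ⊆ Seen O D :=
  fun o ho => ⟨o, ho, fun _ _ => rfl⟩

lemma exists_separating_window {O : Set (Config A)} (hO : O.Finite) :
    ∃ D : Finset (ℤ × ℤ), ∀ o ∈ O, ∀ o' ∈ O, Agree D o o' → o = o' := by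
  classical
  have : ∀ o o' : Config A, ∃ u, o ≠ o' → o u ≠ o' u := by
    intro o o'
    by_cases h : o = o'
    · exact ⟨0, fun h' => (h' h).elim⟩
    · obtain ⟨u, hu⟩ := Function.ne_iff.mp h
      exact ⟨u, fun _ => hu⟩
  choose f hf using this
  refine ⟨(hO.toFinset ×ˢ hO.toFinset).image fun q => f q.1 q.2, fun o ho o' ho' h => ?_⟩
  by_contra hne
  refine hf o o' hne (h _ (Finset.mem_image.mpr ⟨(o, o'), ?_, rfl⟩))
  simp [ho, ho']

lemma exists_coherent {O : Set (Config A)} (hO : O.Finite)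
    (hinv : ∀ v, ∀ o ∈ O, shift v o ∈ O) (D₁ : Finset (ℤ × ℤ)) :
    ∃ D, D₁ ⊆ D ∧ Coherent O D := by
  classical
  obtain ⟨D₀, hD₀⟩ := exists_separating_window hO
  refine ⟨insert 0 (D₁ ∪ (D₀ ∪ unitSteps.biUnion fun e => D₀.image (· + e))), ?_, hinv,
    Finset.mem_insert_self _ _, ?_, ?_⟩
  · exact Finset.subset_union_left.trans (Finset.subset_insert _ _)
  · exact fun o ho o' ho' h => hD₀ o ho o' ho' fun d hd => h d (by simp [hd])
  · intro e he x o ho o' ho' h h'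
    refine hD₀ _ ho' _ (hinv e o ho) fun d hd => ?_
    rw [← h' d (by simp [hd]), shift_apply, shift_apply, h]
    refine Finset.mem_insert_of_mem (Finset.mem_union_right _ (Finset.mem_union_right _ ?_))
    exact Finset.mem_biUnion.mpr ⟨e, he, Finset.mem_image_of_mem _ hd⟩

namespace Coherent

variable {O : Set (Config A)} {D : Finset (ℤ × ℤ)} {x y z : Config A} {v e : ℤ × ℤ}

lemma eq_of_agree (h : Coherent O D) (hy : y ∈ O) (hz : z ∈ O)
    (h1 : Agree D (shift v x) (shift v y)) (h2 : Agree D (shift v x) (shift v z)) : y = z :=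
  shift_injective v
    (h.sep _ (h.shift_mem v y hy) _ (h.shift_mem v z hz) (h1.symm.trans h2))

lemma agree_add_step (h : Coherent O D) (he : e ∈ unitSteps) (hy : y ∈ O)
    (h1 : Agree D (shift v x) (shift v y)) (h2 : shift (v + e) x ∈ Seen O D) :
    Agree D (shift (v + e) x) (shift (v + e) y) := by
  obtain ⟨o, ho, hag⟩ := h2
  rw [add_comm, ← shift_shift] at hag
  have := h.step e he _ _ (h.shift_mem v y hy) _ ho h1 hag
  rw [add_comm, ← shift_shift, ← shift_shift, ← this]
  exact hag

lemma agree_add_nsmul (h : Coherent O D) (he : e ∈ unitSteps) (hy : y ∈ O)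
    (h1 : Agree D (shift v x) (shift v y)) (n : ℕ)
    (h2 : ∀ k ≤ n, shift (v + k • e) x ∈ Seen O D) :
    Agree D (shift (v + n • e) x) (shift (v + n • e) y) := by
  induction n with
  | zero => simpa using h1
  | succ n ih =>
    have := h2 (n + 1) le_rfl
    rw [succ_nsmul, ← add_assoc] at this ⊢
    exact h.agree_add_step he hy (ih fun k hk => h2 k (hk.trans n.le_succ)) this

/-- A configuration seen everywhere as an element of `O` belongs to `O`. -/
lemma mem_of_forall_seen (h : Coherent O D) (hx : ∀ v, shift v x ∈ Seen O D) : x ∈ O := by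
  obtain ⟨o, ho, hag⟩ := hx 0
  have key : ∀ v, Agree D (shift v x) (shift v o) := by
    refine forall_of_unit_steps (by rwa [shift_zero, shift_zero] at *) fun v hv => ?_
    have hstep : ∀ e ∈ unitSteps, Agree D (shift (v + e) x) (shift (v + e) o) :=
      fun e he => h.agree_add_step he ho hv (hx _)
    exact ⟨hstep _ (by decide), hstep _ (by decide), hstep _ (by decide), hstep _ (by decide)⟩
  have : x = o := by
    funext v
    simpa [shift_apply] using key v 0 h.zero_mem
  rwa [this]

lemma apply_eq (h : Coherent O D) (h1 : Agree D (shift v x) (shift v y)) : x v = y v := by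
  simpa [shift_apply] using h1 0 h.zero_mem

/-- On a half-plane all of whose positions are seen, the configuration agrees with a single
element of `O`. -/
lemma exists_agree_halfPlane (h : Coherent O D) {p q C : ℤ} (hpq : p ≠ 0 ∨ q ≠ 0)
    (hx : ∀ v : ℤ × ℤ, C < p * v.1 + q * v.2 → shift v x ∈ Seen O D) :
    ∃ y ∈ O, ∀ v : ℤ × ℤ, C < p * v.1 + q * v.2 → Agree D (shift v x) (shift v y) := by
  have hsign : ∀ r : ℤ, ∃ s : ℤ, (s = 1 ∨ s = -1) ∧ 0 ≤ r * s := by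
    intro r
    rcases le_total 0 r with hr | hr
    · exact ⟨1, Or.inl rfl, by omega⟩
    · exact ⟨-1, Or.inr rfl, by omega⟩
  obtain ⟨s, hs, hps⟩ := hsign p
  obtain ⟨t, ht, hqt⟩ := hsign q
  have hes : ((s, 0) : ℤ × ℤ) ∈ unitSteps := by rcases hs with rfl | rfl <;> decide
  have het : ((0, t) : ℤ × ℤ) ∈ unitSteps := by rcases ht with rfl | rfl <;> decide
  have walk : ∀ v : ℤ × ℤ, C < p * v.1 + q * v.2 → ∀ y ∈ O, Agree D (shift v x) (shift v y) →
      ∀ i j : ℕ, Agree D (shift (v + i • (s, 0) + j • (0, t)) x)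
        (shift (v + i • (s, 0) + j • (0, t)) y) := by
    intro v hv y hy hag i j
    refine h.agree_add_nsmul het hy (h.agree_add_nsmul hes hy hag i fun k _ => hx _ ?_) j
      fun k _ => hx _ ?_
    · have : 0 ≤ (k : ℤ) * (p * s) := by positivity
      simp
      linarith
    · have h1 : 0 ≤ (i : ℤ) * (p * s) := by positivity
      have h2 : 0 ≤ (k : ℤ) * (q * t) := by positivity
      simp
      linarith
  have hseen : ∀ v : ℤ × ℤ, C < p * v.1 + q * v.2 →
      ∃ y ∈ O, Agree D (shift v x) (shift v y) := by
    intro v hv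
    obtain ⟨o, ho, hag⟩ := hx v hv
    exact ⟨shift (-v) o, h.shift_mem _ _ ho, by rwa [shift_shift_neg]⟩
  obtain ⟨v₀, hv₀⟩ : ∃ v₀ : ℤ × ℤ, C < p * v₀.1 + q * v₀.2 := by
    refine ⟨((|C| + 1) * p, (|C| + 1) * q), ?_⟩
    have hpos : 1 ≤ p * p + q * q := by
      rcases hpq with hp | hq
      · nlinarith [mul_self_pos.mpr hp, mul_self_nonneg q]
      · nlinarith [mul_self_pos.mpr hq, mul_self_nonneg p]
    have := le_abs_self C
    nlinarith [abs_nonneg C]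
  obtain ⟨y, hy, hag⟩ := hseen v₀ hv₀
  refine ⟨y, hy, fun v hv => ?_⟩
  obtain ⟨z, hz, hag'⟩ := hseen v hv
  have hw : v₀ + (s * (v.1 - v₀.1)).toNat • (s, 0) + (t * (v.2 - v₀.2)).toNat • (0, t) =
      v + (-(s * (v.1 - v₀.1))).toNat • (s, 0) + (-(t * (v.2 - v₀.2))).toNat • (0, t) := by
    rcases hs with rfl | rfl <;> rcases ht with rfl | rfl <;> ext <;> simp <;> omega
  have h1 := walk v₀ hv₀ y hy hag (s * (v.1 - v₀.1)).toNat (t * (v.2 - v₀.2)).toNat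
  have h2 := walk v hv z hz hag' (-(s * (v.1 - v₀.1))).toNat (-(t * (v.2 - v₀.2))).toNat
  rw [hw] at h1
  rw [h.eq_of_agree hy hz h1 h2]
  exact hag'

end Coherent

variable [TopologicalSpace A]

lemma exists_window {V : Set (Config A)} (hV : IsOpen V) {x : Config A} (hx : x ∈ V) :
    ∃ D : Finset (ℤ × ℤ), ∀ z, Agree D z x → z ∈ V := by
  obtain ⟨I, u, hu, hsub⟩ := isOpen_pi_iff.mp hV x hx
  refine ⟨I, fun z hz => hsub fun d hd => ?_⟩
  rw [hz d hd]
  exact (hu d hd).2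

variable [DiscreteTopology A]

lemma isClopen_setOf_agree (D : Finset (ℤ × ℤ)) (y : Config A) :
    IsClopen {x | Agree D x y} := by
  simp only [Agree, Set.ofPred_forall]
  exact isClopen_biInter_finset fun d _ =>
    (isClopen_discrete {y d}).preimage (continuous_apply d)

lemma isClopen_seen {O : Set (Config A)} (hO : O.Finite) (D : Finset (ℤ × ℤ)) :
    IsClopen (Seen O D) := by
  have : Seen O D = ⋃ o ∈ O, {x | Agree D x o} := by
    ext x
    simp [Seen]
  rw [this]
  exact hO.isClopen_biUnion fun o _ => isClopen_setOf_agree D o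

/-- A countable closed shift-invariant set consisting of finite orbits is finite. -/
lemma finite_of_forall_finite_orbit [Fintype A] {P : Set (Config A)} (hP : IsClosed P)
    (hcount : P.Countable) (hinv : ∀ v, ∀ x ∈ P, shift v x ∈ P)
    (hfin : ∀ x ∈ P, (orbit x).Finite) : P.Finite := by
  classical
  by_contra hinf
  set P' := {x ∈ P | ¬ IsolatedIn P x} with hP'
  have hP'P : P' ⊆ P := fun x hx => hx.1
  have hinv' : ∀ v, ∀ x ∈ P', shift v x ∈ P' := fun v x hx =>
    ⟨hinv v x hx.1, by rw [isolatedIn_shift_iff hinv]; exact hx.2⟩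
  have hne : P'.Nonempty := by
    by_contra hempty
    refine hinf (finite_of_forall_isolatedIn hP.isCompact fun x hx => ?_)
    by_contra hx'
    exact hempty ⟨x, hx, hx'⟩
  obtain ⟨y, hy⟩ := exists_isolatedIn (isClosed_nonIsolated hP) hne (hcount.mono hP'P)
  have hyP : y ∈ P := hy.1.1
  have hO : (orbit y).Finite := hfin y hyP
  have hOiso : ∀ o ∈ orbit y, IsolatedIn P' o := by
    rintro _ ⟨v, rfl⟩
    exact (isolatedIn_shift_iff hinv' v y).mpr hy
  have hwin : ∀ o ∈ orbit y, ∃ D : Finset (ℤ × ℤ), ∀ z ∈ P', Agree D z o → z = o := by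
    intro o ho
    obtain ⟨hoP, V, hV, hoV, hs⟩ := hOiso o ho
    obtain ⟨D, hD⟩ := exists_window hV hoV
    exact ⟨D, fun z hz hag => hs ⟨hD z hag, hz⟩ ⟨hoV, hoP⟩⟩
  choose! W hW using hwin
  obtain ⟨D, hWD, hcoh⟩ := exists_coherent hO (fun v o ho => shift_mem_orbit_of_mem v ho)
    (hO.toFinset.biUnion W)
  have hU := isClopen_seen hO D
  set U := Seen (orbit y) D with hUdef
  have hUP' : ∀ x ∈ P', x ∈ U → x ∈ orbit y := by
    rintro x hx ⟨o, ho, hag⟩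
    rw [hW o ho x hx fun d hd => hag d (hWD (Finset.mem_biUnion.mpr
      ⟨o, hO.mem_toFinset.mpr ho, hd⟩))]
    exact ho
  -- the positions where a configuration of `P` stops looking like `y`
  set E := {x ∈ P ∩ U | ∃ e ∈ unitSteps, shift e x ∉ U} with hE
  have hEP : E ⊆ P := fun x hx => hx.1.1
  have hEclosed : IsClosed E := by
    have : E = (P ∩ U) ∩ ⋃ e ∈ unitSteps, shift e ⁻¹' Uᶜ := by
      ext x
      simp only [hE, Set.mem_ofPred_eq, Set.mem_inter_iff, Set.mem_iUnion, Set.mem_preimage,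
        Set.mem_compl_iff, exists_prop]
    rw [this]
    exact (hP.inter hU.isClosed).inter (isClosed_biUnion_finset fun e _ =>
      hU.compl.isClosed.preimage (continuous_shift e))
  have hEfin : E.Finite := by
    refine finite_of_forall_isolatedIn hEclosed.isCompact fun x hx => ?_
    by_contra hxE
    have hxP' : x ∈ P' := ⟨hx.1.1, fun hiso => hxE (hiso.mono hEP hx)⟩
    obtain ⟨⟨-, hxU⟩, e, -, heU⟩ := hx
    exact heU (subset_seen (shift_mem_orbit_of_mem e (hUP' x hxP' hxU)))
  have hUP : (U ∩ P).Finite := by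
    refine (hO.union (hEfin.biUnion fun x hx => hfin x (hEP hx))).subset ?_
    rintro x ⟨hxU, hxP⟩
    by_cases hxE : ∃ v, shift v x ∈ E
    · obtain ⟨v, hv⟩ := hxE
      exact Or.inr (Set.mem_biUnion hv (mem_orbit_symm (shift_mem_orbit v x)))
    · refine Or.inl (hcoh.mem_of_forall_seen (forall_of_unit_steps (by rwa [shift_zero])
        fun v hv => ?_))
      have hstep : ∀ e ∈ unitSteps, shift (v + e) x ∈ U := by
        intro e he
        by_contra hne
        refine hxE ⟨v, ⟨hinv v x hxP, hv⟩, e, he, ?_⟩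
        rwa [shift_shift, add_comm]
      exact ⟨hstep _ (by decide), hstep _ (by decide), hstep _ (by decide), hstep _ (by decide)⟩
  exact hy.1.2 (isolatedIn_of_finite_inter hyP hU.isOpen (subset_seen (mem_orbit_self y)) hUP)

end Window

/-! ### Gluing along strips -/

section Glue

variable {A : Type*}

lemma exists_abs_le (S : Finset (ℤ × ℤ)) (p q : ℤ) :
    ∃ L : ℤ, ∀ d ∈ S, |p * d.1 + q * d.2| ≤ L := by
  obtain ⟨L, hL⟩ := (S.finite_toSet.image fun d => |p * d.1 + q * d.2|).bddAbove
  exact ⟨L, fun d hd => hL ⟨d, hd, rfl⟩⟩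

/-- Two configurations of an SFT that coincide on a thick enough strip can be glued. -/
lemma IsSFT.exists_glue {X : Set (Config A)} (hX : IsSFT X) (p q : ℤ) :
    ∃ L : ℤ, ∀ x ∈ X, ∀ y ∈ X, ∀ (z : Config A) (α β : ℤ), α + L ≤ β →
      (∀ v : ℤ × ℤ, α < p * v.1 + q * v.2 → z v = x v) →
      (∀ v : ℤ × ℤ, p * v.1 + q * v.2 < β → z v = y v) → z ∈ X := by
  classical
  obtain ⟨-, n, D, f, rfl⟩ := hX
  obtain ⟨L, hL⟩ := exists_abs_le (Finset.univ.biUnion D) p q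
  refine ⟨2 * L + 1, fun x hx y hy z α β hαβ h1 h2 i u hu => ?_⟩
  have hd : ∀ d ∈ D i, |p * d.1 + q * d.2| ≤ L := fun d hd =>
    hL d (Finset.mem_biUnion.mpr ⟨i, Finset.mem_univ i, hd⟩)
  rcases lt_or_ge (α + L) (p * u.1 + q * u.2) with h | h
  · refine hx i u fun d hdi => ?_
    rw [← hu d hdi, h1]
    have := abs_le.mp (hd d hdi)
    simp only [Prod.fst_add, Prod.snd_add, mul_add]
    linarith
  · refine hy i u fun d hdi => ?_
    rw [← hu d hdi, h2]
    have := abs_le.mp (hd d hdi)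
    simp only [Prod.fst_add, Prod.snd_add, mul_add]
    linarith

variable [TopologicalSpace A] [DiscreteTopology A] [Fintype A]

/-- In a countable SFT, a configuration that looks like the same finite orbit on both sides of a
strip belongs to that orbit. -/
lemma IsSFT.mem_orbit_of_same_sides {X : Set (Config A)} (hX : IsSFT X) (hcount : X.Countable)
    {c y : Config A} (hc : c ∈ X) (hy : (orbit y).Finite) {p q C : ℤ} (hpq : p ≠ 0 ∨ q ≠ 0)
    (w : ℤ × ℤ) (h1 : ∀ v : ℤ × ℤ, C < p * v.1 + q * v.2 → c v = y v)
    (h2 : ∀ v : ℤ × ℤ, p * v.1 + q * v.2 < -C → c v = shift w y v) : c ∈ orbit y := by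
  classical
  by_contra hcy
  set Z : Set (Config A) := {x ∈ X | ∃ (a : ℤ × ℤ) (B : ℤ), ∀ v : ℤ × ℤ,
    p * v.1 + q * v.2 < B → x v = shift a y v} with hZ
  have hZX : closure Z ⊆ X := closure_minimal (fun x hx => hx.1) hX.isClosed
  obtain ⟨x, hxZ, V, hV, hxV, hs⟩ := exists_isolatedIn (isClosed_closure (s := Z))
    ⟨c, subset_closure ⟨hc, w, -C, h2⟩⟩ (hcount.mono hZX)
  obtain ⟨x₀, hx₀V, hx₀Z⟩ := mem_closure_iff.mp hxZ V hV hxV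
  obtain rfl : x₀ = x := hs ⟨hx₀V, subset_closure hx₀Z⟩ ⟨hxV, hxZ⟩
  obtain ⟨hxX, a, B, hB⟩ := hx₀Z
  obtain ⟨D, hD⟩ := exists_window hV hxV
  obtain ⟨M, hM⟩ := exists_abs_le D p q
  obtain ⟨L, hL⟩ := hX.exists_glue p q
  obtain ⟨n, hn, hper⟩ := exists_nsmul_period hy (p, q)
  have hpos : 1 ≤ p * p + q * q := by
    rcases hpq with hp | hq
    · nlinarith [mul_self_pos.mpr hp, mul_self_nonneg q]
    · nlinarith [mul_self_pos.mpr hq, mul_self_nonneg p]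
  -- a far translate `shift b c` of `c` whose upper side continues the lower side of `x₀`
  obtain ⟨b, hby, hb⟩ : ∃ b : ℤ × ℤ, shift b y = shift a y ∧
      |C| + |B| + |L| + |M| < p * b.1 + q * b.2 := by
    set R := |C| + |B| + |L| + |M| + |p * a.1 + q * a.2| + 1
    refine ⟨a + R.toNat • n • (p, q), ?_, ?_⟩
    · rw [← shift_shift, nsmul_period hper]
    · have hR : 0 ≤ R := by positivity
      have hn' : (1 : ℤ) ≤ n := by exact_mod_cast hn
      have h3 : R * 1 ≤ R * (n * (p * p + q * q)) := by
        apply mul_le_mul_of_nonneg_left _ hR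
        nlinarith
      have h4 := neg_abs_le (p * a.1 + q * a.2)
      simp only [Prod.fst_add, Prod.snd_add, Prod.smul_mk, nsmul_eq_mul]
      rw [Int.toNat_of_nonneg hR]
      simp only [R] at h3 ⊢
      linarith
  set α := C - (p * b.1 + q * b.2) with hα
  have hupper : ∀ v : ℤ × ℤ, α < p * v.1 + q * v.2 → shift b c v = shift a y v := by
    intro v hv
    rw [← hby, shift_apply, shift_apply, h1]
    simp only [Prod.fst_add, Prod.snd_add, mul_add]
    linarith
  have hC := abs_le.mp (le_refl |C|)
  have hB' := abs_le.mp (le_refl |B|)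
  have hL' := abs_le.mp (le_refl |L|)
  have hM' := abs_le.mp (le_refl |M|)
  set z : Config A := fun v => if α < p * v.1 + q * v.2 then x₀ v else shift b c v with hz
  have hzx : ∀ v : ℤ × ℤ, α < p * v.1 + q * v.2 → z v = x₀ v := fun v hv => if_pos hv
  have hzc : ∀ v : ℤ × ℤ, p * v.1 + q * v.2 < B → z v = shift b c v := by
    intro v hv
    by_cases hv' : α < p * v.1 + q * v.2
    · rw [hzx v hv', hB v hv, hupper v hv']
    · exact if_neg hv'
  have hzX : z ∈ X := hL x₀ hxX (shift b c) (hX.shift_mem b hc) z α B (by linarith) hzx hzc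
  have hzZ : z ∈ Z := by
    refine ⟨hzX, b + w, min B (-C - (p * b.1 + q * b.2)), fun v hv => ?_⟩
    have hv' := lt_min_iff.mp hv
    rw [hzc v hv'.1, ← shift_shift, shift_apply b, shift_apply b, h2]
    simp only [Prod.fst_add, Prod.snd_add, mul_add]
    linarith
  have hzV : z ∈ V := hD z fun d hd => hzx d (by
    have := abs_le.mp (hM d hd)
    linarith)
  have hzeq : z = x₀ := hs ⟨hzV, subset_closure hzZ⟩ ⟨hxV, hxZ⟩
  have hcb : shift b c = shift a y := by
    funext v
    by_cases hv : α < p * v.1 + q * v.2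
    · exact hupper v hv
    · have hvB : p * v.1 + q * v.2 < B := by linarith
      rw [← hzc v hvB, hzeq, hB v hvB]
  rw [← hby] at hcb
  exact hcy (shift_injective b hcb ▸ mem_orbit_self y)

end Glue

section Stabilizer

variable {A : Type*} {c : Config A} {a b : ℤ}

/-- The shifts of a configuration of period `(a, b) ≠ 0` by vectors in a strip parallel to
`(a, b)` are finitely many. -/
lemma finite_shifts_strip (hper : shift (a, b) c = c) (hab : (a, b) ≠ (0 : ℤ × ℤ)) (C : ℤ) :
    ((fun v => shift v c) '' {v : ℤ × ℤ | |-b * v.1 + a * v.2| ≤ C}).Finite := by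
  have hpos : 0 < a * a + b * b := by
    by_contra hle
    refine hab (Prod.ext ?_ ?_) <;> simp <;> nlinarith [mul_self_nonneg a, mul_self_nonneg b]
  set g : ℤ × ℤ → ℤ × ℤ := fun v => (a * v.1 + b * v.2, -b * v.1 + a * v.2) with hg
  have hinj : Function.Injective g := by
    intro v w h
    have h1 : a * v.1 + b * v.2 = a * w.1 + b * w.2 := congrArg Prod.fst h
    have h2 : -b * v.1 + a * v.2 = -b * w.1 + a * w.2 := congrArg Prod.snd h
    have h3 : (a * a + b * b) * v.1 = (a * a + b * b) * w.1 := by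
      linear_combination a * h1 - b * h2
    have h4 : (a * a + b * b) * v.2 = (a * a + b * b) * w.2 := by
      linear_combination b * h1 + a * h2
    exact Prod.ext (mul_left_cancel₀ hpos.ne' h3) (mul_left_cancel₀ hpos.ne' h4)
  have hfin : (g ⁻¹' (Set.Icc 0 (a * a + b * b) ×ˢ Set.Icc (-C) C)).Finite :=
    ((Set.finite_Icc _ _).prod (Set.finite_Icc _ _)).preimage hinj.injOn
  refine (hfin.image fun v => shift v c).subset ?_
  rintro _ ⟨v, hv, rfl⟩
  set k := (a * v.1 + b * v.2) / (a * a + b * b) with hk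
  have hdiv := Int.mul_ediv_add_emod (a * v.1 + b * v.2) (a * a + b * b)
  have hnn := Int.emod_nonneg (a * v.1 + b * v.2) hpos.ne'
  have hlt := Int.emod_lt_of_pos (a * v.1 + b * v.2) hpos
  refine ⟨v - k • (a, b), ?_, ?_⟩
  · have hv' : |-b * v.1 + a * v.2| ≤ C := hv
    rw [abs_le] at hv'
    rw [← hk] at hdiv
    simp only [hg, Set.mem_preimage, Set.mem_prod, Set.mem_Icc, Prod.fst_sub, Prod.snd_sub,
      Prod.smul_mk, smul_eq_mul]
    refine ⟨⟨by linarith, by linarith⟩, by linarith, by linarith⟩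
  · have : shift (-(k • (a, b))) c = c := by
      rw [← neg_smul]
      exact zsmul_period hper _
    show shift (v - k • (a, b)) c = shift v c
    rw [sub_eq_add_neg, ← shift_shift, this]

/-- Two independent periods make the orbit finite. -/
lemma finite_orbit_of_periods (hper : shift (a, b) c = c) (hab : (a, b) ≠ (0 : ℤ × ℤ))
    {w : ℤ × ℤ} (hw : shift w c = c) (hdet : -b * w.1 + a * w.2 ≠ 0) : (orbit c).Finite := by
  set δ := -b * w.1 + a * w.2 with hδ
  refine (finite_shifts_strip hper hab |δ|).subset ?_
  rintro _ ⟨v, rfl⟩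
  set k := (-b * v.1 + a * v.2) / δ with hk
  have hdiv := Int.mul_ediv_add_emod (-b * v.1 + a * v.2) δ
  have hnn := Int.emod_nonneg (-b * v.1 + a * v.2) hdet
  have hlt := Int.emod_lt_abs (-b * v.1 + a * v.2) hdet
  rw [← hk] at hdiv
  refine ⟨v - k • w, ?_, ?_⟩
  · show |-b * (v - k • w).1 + a * (v - k • w).2| ≤ |δ|
    have : -b * (v - k • w).1 + a * (v - k • w).2 = (-b * v.1 + a * v.2) % δ := by
      simp only [Prod.fst_sub, Prod.snd_sub, Prod.smul_fst, Prod.smul_snd, smul_eq_mul]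
      linear_combination k * hδ - hdiv
    rw [this, abs_of_nonneg hnn]
    exact hlt.le
  · have : shift (-(k • w)) c = c := by
      rw [← neg_smul]
      exact zsmul_period hw _
    show shift (v - k • w) c = shift v c
    rw [sub_eq_add_neg, ← shift_shift, this]

end Stabilizer

theorem stmt13 {A : Type*} [Fintype A] [Nonempty A] [TopologicalSpace A] [DiscreteTopology A]
    (X : Set (Config A)) (hX : IsSFT X) (hcount : X.Countable)
    (c : Config A) (hc : Level1 X c) :
    ∃ y₁ ∈ X, ∃ y₂ ∈ X, Prec y₁ c ∧ Prec y₂ c ∧ ¬ OrbEquiv y₁ y₂ ∧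
      ∀ y ∈ X, Prec y c → OrbEquiv y y₁ ∨ OrbEquiv y y₂ := by
  obtain ⟨hcX, hc0, hc1⟩ := hc
  set K := closure (orbit c) with hK
  have hKX : K ⊆ X := hX.closure_orbit_subset hcX
  have hKinv : ∀ v, ∀ x ∈ K, shift v x ∈ K := fun v x hx => shift_mem_closure_orbit v hx
  have hiso : IsolatedIn K c := isolatedIn_closure_orbit (hcount.mono hKX)
  have hKiso : ∀ x ∈ orbit c, IsolatedIn K x := by
    rintro _ ⟨v, rfl⟩
    exact (isolatedIn_shift_iff hKinv v c).mpr hiso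
  set P := {x ∈ K | x ∉ orbit c} with hPdef
  have hprec : ∀ x, Prec x c ↔ x ∈ P := fun x =>
    ⟨fun h => ⟨h.1, fun hx => h.2 (preceq_of_mem_orbit (mem_orbit_symm hx))⟩,
      fun h => ⟨h.1, fun hcx => h.2 (mem_orbit_of_preceq hiso h.1 hcx)⟩⟩
  have hPinv : ∀ v, ∀ x ∈ P, shift v x ∈ P := fun v x hx =>
    ⟨hKinv v x hx.1, fun h => hx.2 (by
      simpa only [shift_neg_shift] using shift_mem_orbit_of_mem (-v) h)⟩
  have hPorb : ∀ x ∈ P, (orbit x).Finite := fun x hx =>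
    (hc1 x (hKX hx.1) ((hprec x).mpr hx)).finite_orbit hX hcount
  have hcP : ∀ y ∈ P, c ∉ orbit y := fun y hy h => hy.2 (mem_orbit_symm h)
  have hcinf : ¬ (orbit c).Finite := fun hfin => hc0 ⟨hcX, fun y _ hyc => by
    have : y ∈ orbit c := by
      rwa [Preceq, hfin.isClosed.closure_eq] at hyc
    exact preceq_of_mem_orbit (mem_orbit_symm this)⟩
  have hPclosed : IsClosed P := by
    have : P = {x ∈ K | ¬ IsolatedIn K x} := by
      ext x
      refine ⟨fun h => ⟨h.1, fun hx => h.2 ?_⟩, fun h => ⟨h.1, fun hx => h.2 (hKiso x hx)⟩⟩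
      obtain ⟨hxK, V, hV, hxV, hs⟩ := hx
      obtain ⟨z, hzV, hz⟩ := mem_closure_iff.mp hxK V hV hxV
      rwa [← hs ⟨hzV, subset_closure hz⟩ ⟨hxV, hxK⟩]
    rw [this]
    exact isClosed_nonIsolated isClosed_closure
  have hPfin : P.Finite := finite_of_forall_finite_orbit hPclosed
    (hcount.mono fun x hx => hKX hx.1) hPinv hPorb
  obtain ⟨D, -, hcoh⟩ := exists_coherent hPfin hPinv ∅
  have hUclopen := isClopen_seen hPfin D
  set U := Seen P D with hU
  have hKU : (K \ U).Finite := by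
    refine finite_of_forall_isolatedIn (isClosed_closure.sdiff hUclopen.isOpen).isCompact
      fun x hx => (hKiso x ?_).mono Set.sdiff_subset hx
    by_contra hxo
    exact hx.2 (subset_seen ⟨hx.1, hxo⟩)
  set T := {v : ℤ × ℤ | shift v c ∉ U} with hT
  have hTfin : ((fun v => shift v c) '' T).Finite := by
    refine hKU.subset ?_
    rintro _ ⟨v, hv, rfl⟩
    exact ⟨subset_closure (shift_mem_orbit v c), hv⟩
  have hsides : ∀ p q C : ℤ, p ≠ 0 ∨ q ≠ 0 → (∀ v ∈ T, |p * v.1 + q * v.2| ≤ C) →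
      ∃ y ∈ P, ∃ z ∈ P,
        (∀ v : ℤ × ℤ, C < p * v.1 + q * v.2 → Agree D (shift v c) (shift v y)) ∧
        (∀ v : ℤ × ℤ, p * v.1 + q * v.2 < -C → Agree D (shift v c) (shift v z)) ∧
        z ∉ orbit y := by
    intro p q C hpq hbound
    obtain ⟨y, hy, hyag⟩ := hcoh.exists_agree_halfPlane (x := c) (C := C) hpq fun v hv => by
      by_contra hvT
      have := abs_le.mp (hbound v hvT)
      linarith
    obtain ⟨z, hz, hzag⟩ := hcoh.exists_agree_halfPlane (x := c) (p := -p) (q := -q) (C := C)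
      (by simpa using hpq) fun v hv => by
        by_contra hvT
        have := abs_le.mp (hbound v hvT)
        linarith
    have hzag' : ∀ v : ℤ × ℤ, p * v.1 + q * v.2 < -C → Agree D (shift v c) (shift v z) :=
      fun v hv => hzag v (by linarith)
    refine ⟨y, hy, z, hz, hyag, hzag', ?_⟩
    rintro ⟨w, rfl⟩
    exact hcP y hy (hX.mem_orbit_of_same_sides hcount hcX (hPorb y hy) hpq w
      (fun v hv => hcoh.apply_eq (hyag v hv)) fun v hv => hcoh.apply_eq (hzag' v hv))
  -- `c` has a nonzero period
  obtain ⟨⟨a, b⟩, hper, hab⟩ : ∃ u : ℤ × ℤ, shift u c = c ∧ u ≠ 0 := by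
    by_contra hno
    push Not at hno
    have hinj : ∀ v w : ℤ × ℤ, shift v c = shift w c → v = w := fun v w h =>
      sub_eq_zero.mp (hno _ (shift_sub_eq_self h))
    obtain ⟨B, hB⟩ := (finite_image_of_factor (g := fun v : ℤ × ℤ => |v.1| + |v.2|) hTfin
      fun v w h => by rw [hinj v w h]).bddAbove
    have hB' : ∀ v ∈ T, |v.1| + |v.2| ≤ B := fun v hv => hB ⟨v, hv, rfl⟩
    obtain ⟨y, hy, z, hz, hyag, hzag, hne⟩ := hsides 0 1 |B| (by simp) fun v hv => by
      have := hB' v hv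
      have := abs_nonneg v.1
      have := le_abs_self B
      simp only [zero_mul, one_mul, zero_add]
      linarith
    have hBnn := abs_nonneg B
    have h1 := hzag (|B| + 1, -|B| - 1) (by simp)
    have h2 := hcoh.agree_add_nsmul (e := (0, 1)) (by decide) hz h1 (2 * (|B| + 1)).toNat
      fun k _ => by
        by_contra hvT
        have := hB' _ hvT
        have h3 := le_abs_self B
        simp only [Prod.fst_add, Prod.snd_add, Prod.smul_mk, smul_zero, add_zero] at this
        rw [abs_of_pos (by linarith : 0 < |B| + 1)] at this
        have := abs_nonneg (-|B| - 1 + k • (1 : ℤ))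
        linarith
    have h4 := hyag ((|B| + 1, -|B| - 1) + (2 * (|B| + 1)).toNat • ((0, 1) : ℤ × ℤ)) (by
      simp
      omega)
    rw [hcoh.eq_of_agree hz hy h2 h4] at hne
    exact hne (mem_orbit_self y)
  have hker : ∀ w, shift w c = c → -b * w.1 + a * w.2 = 0 := fun w hw => by
    by_contra hdet
    exact hcinf (finite_orbit_of_periods hper hab hw hdet)
  obtain ⟨C, hC⟩ := (finite_image_of_factor (g := fun v : ℤ × ℤ => |-b * v.1 + a * v.2|) hTfin
    fun v w h => by
      have := hker _ (shift_sub_eq_self h)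
      simp only [Prod.fst_sub, Prod.snd_sub] at this
      exact congrArg abs (by linarith)).bddAbove
  obtain ⟨y, hy, z, hz, hyag, hzag, hne⟩ := hsides (-b) a C (by
    by_contra hcon
    push Not at hcon
    exact hab (Prod.ext hcon.2 (neg_eq_zero.mp hcon.1))) fun v hv => hC ⟨v, hv, rfl⟩
  refine ⟨y, hKX hy.1, z, hKX hz.1, (hprec y).mpr hy, (hprec z).mpr hz, ?_, ?_⟩
  · rintro ⟨-, hzy⟩
    rw [Preceq, (hPorb y hy).isClosed.closure_eq] at hzy
    exact hne hzy
  · intro x _ hx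
    have hxP := (hprec x).mp hx
    have hstrip := finite_shifts_strip hper hab C
    have hopen : IsOpen ({u | Agree D u x} \
        ((fun v => shift v c) '' {v : ℤ × ℤ | |-b * v.1 + a * v.2| ≤ C})) :=
      (isClopen_setOf_agree D x).isOpen.sdiff hstrip.isClosed
    obtain ⟨_, ⟨hux, hus⟩, v, rfl⟩ := mem_closure_iff.mp hxP.1 _ hopen
      ⟨fun _ _ => rfl, fun ⟨v, _, hv⟩ => hxP.2 ⟨v, hv⟩⟩
    have hv : C < |-b * v.1 + a * v.2| := by
      by_contra hle
      exact hus ⟨v, not_lt.mp hle, rfl⟩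
    have hfind : ∀ o ∈ P, Agree D (shift v c) (shift v o) → OrbEquiv x o := by
      intro o ho hag
      have : x = shift v o := hcoh.sep _ hxP _ (hPinv v o ho) (Agree.trans (Agree.symm hux) hag)
      exact orbEquiv_of_mem_orbit ⟨v, this.symm⟩
    rcases lt_abs.mp hv with h | h
    · exact Or.inl (hfind y hy (hyag v h))
    · exact Or.inr (hfind z hz (hzag v (by linarith)))

end CountableSubshift
end
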